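/- Let C = Orb(S) with S ∈ G_q(n,k) and let m = m(C). If m < n and ω_{2k−2}(C) ≠ 0, then k ≤ (m+1)/2. If m = n and ω_{2k}(C) ≠ 0, then k ≤ n/2. -/

import Mathlib

/-!
Setting: `q` is a prime power, realized by a finite field `Fq` with `Fintype.card Fq = q`;
`F` plays the role of `F_{q^n}`: a finite field extension of `Fq` with `Module.finrank Fq F = n`.
`F_q`-subspaces of `F_{q^n}` are `Submodule Fq F`; for a divisor `t` of `n`, the subfield
`F_{q^t}` is the (unique) `T : IntermediateField Fq F` with `Module.finrank Fq ↥T = t`, and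
`F_{q^t}`-subspaces are `Submodule ↥T F`.
-/

set_option synthInstance.maxHeartbeats 1000000

namespace FWS

variable (R : Type*) {F : Type*} [Field R] [Field F] [Algebra R F]

/-- The cyclic shift `α S = {α * s : s ∈ S}` of an `R`-subspace `S` of `F`. -/
def shift (α : F) (S : Submodule R F) : Submodule R F :=
  S.map (LinearMap.mulLeft R α)

/-- The subspace distance `d(U,V) = dim U + dim V - 2 dim (U ⊓ V)`
(which is `2k - 2 dim (U ⊓ V)` for `U, V` of the same dimension `k`). -/
noncomputable def sdist (U V : Submodule R F) : ℕ :=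
  Module.finrank R ↥U + Module.finrank R ↥V - 2 * Module.finrank R ↥(U ⊓ V)

/-- The one-orbit cyclic subspace code `Orb(S) = {α S : α ∈ F*}`. -/
def orb (S : Submodule R F) : Set (Submodule R F) :=
  {T | ∃ α : F, α ≠ 0 ∧ T = shift R α S}

/-- The weight `ω_{2i}(Orb(S)) = #{α S : α ∈ F*, d(S, α S) = 2 i}`. -/
noncomputable def omega (S : Submodule R F) (i : ℕ) : ℕ :=
  Nat.card {T : Submodule R F // T ∈ orb R S ∧ sdist R S T = 2 * i}

/-- `Orb(S)` is a full weight spectrum (FWS) code: `ω_{2i} > 0` for all `1 ≤ i ≤ dim S`. -/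
def IsFWS (S : Submodule R F) : Prop :=
  ∀ i : ℕ, 1 ≤ i → i ≤ Module.finrank R ↥S → 0 < omega R S i

/-- The subspace `⟨1, l, ..., l^(k-1)⟩_R` spanned by the first `k` powers of `l`. -/
def polySpan (l : F) (k : ℕ) : Submodule R F :=
  Submodule.span R ((fun i : ℕ => l ^ i) '' Set.Iio k)

/-- The invariant `m(Orb(S))`: the least divisor `t` of `n` such that
`dim_{F_{q^t}} ⟨S⟩_{F_{q^t}} = 1` (equivalently, the degree of the smallest subfield
containing a cyclic shift of `S`). -/
noncomputable def mOrb (S : Submodule R F) : ℕ :=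
  sInf {t : ℕ | t ∣ Module.finrank R F ∧
    ∃ T : IntermediateField R F, Module.finrank R ↥T = t ∧
      Module.finrank ↥T ↥(Submodule.span ↥T (S : Set F)) = 1}

/-- The stabilizer `H(S) = {x ∈ F* : x S = S} ∪ {0}` of a set `S ⊆ F`, as a subset of `F`
(it is a subfield of `F` when `S` is a subspace). -/
def stab {F : Type*} [Field F] (S : Set F) : Set F :=
  {x : F | x ≠ 0 ∧ (fun y => x * y) '' S = S} ∪ {0}

end FWS

namespace FWS

variable {R F : Type*} [Field R] [Field F] [Algebra R F]

lemma mem_shift {α x : F} {S : Submodule R F} :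
    x ∈ shift R α S ↔ ∃ s ∈ S, α * s = x := by
  simp [shift]

lemma finrank_shift {α : F} (hα : α ≠ 0) (S : Submodule R F) :
    Module.finrank R (shift R α S) = Module.finrank R S :=
  (Submodule.equivMapOfInjective (LinearMap.mulLeft R α)
    (mul_right_injective₀ hα) S).finrank_eq.symm

/-- A nonzero weight gives a shift realizing the corresponding intersection dimension. -/
lemma exists_shift_of_omega_ne_zero [FiniteDimensional R F] {S : Submodule R F} {i : ℕ}
    (hi : omega R S i ≠ 0) :
    ∃ α : F, α ≠ 0 ∧
      Module.finrank R ↥(S ⊓ shift R α S) + i = Module.finrank R S := by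
  obtain ⟨⟨_, ⟨α, hα, rfl⟩, hd⟩⟩ := (Nat.card_ne_zero.mp hi).1
  refine ⟨α, hα, ?_⟩
  have hle : Module.finrank R ↥(S ⊓ shift R α S) ≤ Module.finrank R S :=
    Submodule.finrank_mono inf_le_left
  rw [sdist, finrank_shift hα] at hd
  omega

lemma mOrb_spec {S : Submodule R F} (hS : S ≠ ⊥) :
    mOrb R S ∣ Module.finrank R F ∧
      ∃ T : IntermediateField R F, Module.finrank R T = mOrb R S ∧
        Module.finrank T (Submodule.span T (S : Set F)) = 1 := by
  refine Nat.sInf_mem (s := {t : ℕ | t ∣ Module.finrank R F ∧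
    ∃ T : IntermediateField R F, Module.finrank R ↥T = t ∧
      Module.finrank ↥T ↥(Submodule.span ↥T (S : Set F)) = 1})
    ⟨Module.finrank R F, dvd_rfl, ⊤, IntermediateField.finrank_top', ?_⟩
  obtain ⟨v, hv, hv0⟩ := S.exists_mem_ne_zero_of_ne_bot hS
  refine (finrank_eq_one_iff_of_nonzero' (⟨v, Submodule.subset_span hv⟩ :
    Submodule.span (⊤ : IntermediateField R F) (S : Set F)) ?_).mpr ?_
  · simpa [Subtype.ext_iff] using hv0
  · rintro ⟨w, hw⟩
    exact ⟨⟨w / v, trivial⟩, Subtype.ext (div_mul_cancel₀ w hv0)⟩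

/-- A subspace whose span over a subfield `T` is a line lies in a cyclic shift of `T`. -/
lemma exists_le_shift_of_finrank_span_eq_one {S : Submodule R F} {T : IntermediateField R F}
    (h : Module.finrank T (Submodule.span T (S : Set F)) = 1) :
    ∃ b : F, b ≠ 0 ∧ S ≤ shift R b (Subalgebra.toSubmodule T.toSubalgebra) := by
  obtain ⟨⟨b, hb⟩, hb0, hspan⟩ := finrank_eq_one_iff'.mp h
  refine ⟨b, fun h0 => hb0 (Subtype.ext h0), fun s hs => ?_⟩
  obtain ⟨c, hc⟩ := hspan ⟨s, Submodule.subset_span hs⟩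
  exact mem_shift.mpr ⟨c, c.2, (mul_comm _ _).trans (congrArg Subtype.val hc)⟩

/-- If `S ≤ bT` meets `αS` nontrivially then `α ∈ T`, hence `αS ≤ bT`. -/
lemma shift_le_shift_of_inf_ne_bot {S : Submodule R F} {T : IntermediateField R F} {α b : F}
    (hb : b ≠ 0) (hS : S ≤ shift R b (Subalgebra.toSubmodule T.toSubalgebra))
    (hα : S ⊓ shift R α S ≠ ⊥) :
    shift R α S ≤ shift R b (Subalgebra.toSubmodule T.toSubalgebra) := by
  obtain ⟨v, ⟨hvS, hvα⟩, hv0⟩ := Submodule.exists_mem_ne_zero_of_ne_bot hα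
  obtain ⟨s, hs, rfl⟩ := mem_shift.mp hvα
  obtain ⟨t, ht, hbt⟩ := mem_shift.mp (hS hs)
  obtain ⟨u, hu, hbu⟩ := mem_shift.mp (hS hvS)
  have ht0 : t ≠ 0 := by
    rintro rfl
    exact hv0 (by simp [← hbt])
  have hαT : α ∈ T := by
    have : α = u / t := by
      rw [eq_div_iff ht0]
      apply mul_left_cancel₀ hb
      rw [hbu, ← hbt]
      ring
    rw [this]
    exact div_mem hu ht
  intro x hx
  obtain ⟨y, hy, rfl⟩ := mem_shift.mp hx
  obtain ⟨z, hz, rfl⟩ := mem_shift.mp (hS hy)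
  exact mem_shift.mpr ⟨α * z, T.mul_mem hαT hz, by ring⟩

end FWS

open FWS

/-- Proposition 4.1: bounds from nonzero extremal weights.
If `m := m(Orb(S)) < n` and `ω_{2k-2} ≠ 0` then `k ≤ (m+1)/2`;
if `m = n` and `ω_{2k} ≠ 0` then `k ≤ n/2`. -/
theorem bounds_from_extremal_weights
    {Fq F : Type*} [Field Fq] [Field F] [Algebra Fq F] [Fintype Fq] [Fintype F]
    (q n k : ℕ) (hq : Fintype.card Fq = q) (hn : Module.finrank Fq F = n)
    (S : Submodule Fq F) (hSk : Module.finrank Fq ↥S = k) (hk : 1 ≤ k) :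
    (mOrb Fq S < n → omega Fq S (k - 1) ≠ 0 → 2 * k ≤ mOrb Fq S + 1) ∧
    (mOrb Fq S = n → omega Fq S k ≠ 0 → 2 * k ≤ n) := by
  have : FiniteDimensional Fq F := Module.Finite.of_finite
  constructor
  · intro _ hω
    obtain ⟨α, hα, hdim⟩ := exists_shift_of_omega_ne_zero hω
    have hinf : Module.finrank Fq ↥(S ⊓ shift Fq α S) = 1 := by omega
    have hS : S ≠ ⊥ := by
      rintro rfl
      simp at hSk
      omega
    obtain ⟨-, T, hT, hspan⟩ := mOrb_spec hS
    obtain ⟨b, hb, hSb⟩ := exists_le_shift_of_finrank_span_eq_one hspan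
    have hne : S ⊓ shift Fq α S ≠ ⊥ := by
      intro h
      rw [h, finrank_bot] at hinf
      omega
    have hle := Submodule.finrank_mono
      (sup_le hSb (shift_le_shift_of_inf_ne_bot hb hSb hne))
    have hsum := Submodule.finrank_sup_add_finrank_inf_eq S (shift Fq α S)
    rw [finrank_shift hb] at hle
    rw [finrank_shift hα] at hsum
    change _ ≤ Module.finrank Fq T at hle
    omega
  · intro _ hω
    obtain ⟨α, hα, hdim⟩ := exists_shift_of_omega_ne_zero hω
    have hle := Submodule.finrank_le (S ⊔ shift Fq α S)
    have hsum := Submodule.finrank_sup_add_finrank_inf_eq S (shift Fq α S)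
    rw [finrank_shift hα] at hsum
    omega
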